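/- arXiv:2112.13405 — 4 statements merged into one kernel-verified Lean document; each statement's English description precedes it below -/
import Mathlib

section
/- For ρ = 0, the classes of the elements z^{i}·u_0 for i ∈ I_k together with the classes of u_j for 0 ≤ j ≤ k form a ℂ-basis of coker(θ_0 : Λ_0 → Λ_0) = H^1_dR(𝔾_m, Sym^k Ai), where I_k = {1, …, k′+1} if k is odd and I_k = {1, …, k′} if k is even. (These are the classes of the forms ω_i = z^{i−1}u_0 dz and η_j = u_j dz/z.) -/
/-- The operator `z·d/dz` on the space `ℤ →₀ ℂ` of Laurent polynomials in `z`
(a Laurent polynomial being recorded by its finitely supported coefficient function,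
`single n c` standing for `c·zⁿ`): it multiplies the coefficient of `zⁿ` by `n`. -/
noncomputable def zdz : (ℤ →₀ ℂ) →ₗ[ℂ] (ℤ →₀ ℂ) :=
  Finsupp.lsum ℂ fun n => (n : ℂ) • Finsupp.lsingle n

/-- Multiplication by `z^m` on Laurent polynomials. -/
noncomputable def shiftT (m : ℤ) : (ℤ →₀ ℂ) →ₗ[ℂ] (ℤ →₀ ℂ) :=
  Finsupp.lmapDomain ℂ ℂ (· + m)

/-- The operator `z∂_z` on `Λ_ρ = ⊕_{a=0}^k ℂ[z,z⁻¹]·u_a`, the module of global sections over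
`𝔾_m` of `V_ρ` (where `V_0 = Sym^k Ai` and `V_{1/2} = L ⊗ Sym^k Ai`):
`θ_ρ(p·u_a) = z·p′·u_a + p·(ρ·u_a + (k−a)·z·u_{a+1} + a·z²·u_{a−1})`. -/
noncomputable def theta (k : ℕ) (ρ : ℂ) :
    (Fin (k + 1) → (ℤ →₀ ℂ)) →ₗ[ℂ] (Fin (k + 1) → (ℤ →₀ ℂ)) :=
  LinearMap.pi fun b =>
    zdz.comp (LinearMap.proj b) + ρ • LinearMap.proj b
    + (if 1 ≤ (b : ℕ) then
        ((k - ((b : ℕ) - 1) : ℕ) : ℂ) •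
          (shiftT 1).comp (LinearMap.proj ⟨(b : ℕ) - 1, by have := b.isLt; omega⟩)
      else 0)
    + (if h : (b : ℕ) + 1 ≤ k then
        (((b : ℕ) + 1 : ℕ) : ℂ) •
          (shiftT 2).comp (LinearMap.proj ⟨(b : ℕ) + 1, by omega⟩)
      else 0)

/-- The element `p·u_a` of `Λ_ρ`. -/
noncomputable def eL (k : ℕ) (a : Fin (k + 1)) (p : ℤ →₀ ℂ) : Fin (k + 1) → (ℤ →₀ ℂ) :=
  fun b => if b = a then p else 0

/-- The family of classes `z·u_0, …, z^m·u_0, u_0, u_1, …, u_k` in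
`H¹_dR(𝔾_m, V_ρ) = coker(θ_ρ : Λ_ρ → Λ_ρ)`. -/
noncomputable def famL (k m : ℕ) (ρ : ℂ) :
    (Fin m ⊕ Fin (k + 1)) → ((Fin (k + 1) → (ℤ →₀ ℂ)) ⧸ LinearMap.range (theta k ρ)) :=
  Sum.elim
    (fun i => Submodule.Quotient.mk (eL k 0 (Finsupp.single ((i : ℕ) + 1 : ℤ) 1)))
    (fun j => Submodule.Quotient.mk (eL k j (Finsupp.single 0 1)))

/-- A family of scalars satisfying the relations of a linear functional on `coker θ_0`, and
vanishing on the proposed basis, vanishes identically. -/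
theorem dual_family_eq_zero (k m : ℕ)
    (hk : (∃ t, k = 2 * t + 1 ∧ m = t + 1) ∨ ∃ t, k = 2 * t + 2 ∧ t = m)
    (L : ℕ → ℤ → ℂ)
    (hrel : ∀ a ≤ k, ∀ n : ℤ,
      n * L a n + ((k : ℂ) - a) * L (a + 1) (n + 1) + a * L (a - 1) (n + 2) = 0)
    (hL0 : ∀ j ≤ k, L j 0 = 0) (hLi : ∀ i : ℤ, 1 ≤ i → i ≤ m → L 0 i = 0) :
    ∀ b ≤ k, ∀ n, L b n = 0 := by
  have nonneg : ∀ w : ℕ, ∀ b ≤ k, ∀ n : ℤ, 0 ≤ n → 2 * n + b = w → L b n = 0 := by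
    intro w
    induction w using Nat.strong_induction_on with
    | _ w ih =>
    have hN : ∀ a ≤ k, ∀ n : ℤ, 0 ≤ n → 2 * n + a + 3 = w →
        ((k : ℂ) - a) * L (a + 1) (n + 1) + a * L (a - 1) (n + 2) = 0 := by
      intro a ha n hn hw
      have h0 : L a n = 0 := ih (2 * n + a).toNat (by omega) a ha n hn (by omega)
      have := hrel a ha n
      rw [h0] at this
      linear_combination this
    have hodd : ∀ j : ℕ, 2 * j + 1 ≤ k → ∀ n : ℤ, 0 ≤ n → 2 * n + (2 * j + 1) = w →
        L (2 * j + 1) n = 0 := by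
      intro j
      induction j with
      | zero =>
        intro hj n hn hw
        rcases hn.eq_or_lt with rfl | hn
        · exact hL0 _ hj
        have h := hN 0 (by omega) (n - 1) (by omega) (by push_cast; omega)
        have hk0 : (k : ℂ) ≠ 0 := Nat.cast_ne_zero.2 (by omega)
        simpa [hk0] using h
      | succ j ihj =>
        intro hj n hn hw
        rcases hn.eq_or_lt with rfl | hn
        · exact hL0 _ hj
        have h := hN (2 * j + 2) (by omega) (n - 1) (by omega) (by push_cast at hw ⊢; omega)
        rw [show 2 * j + 2 - 1 = 2 * j + 1 by omega,
          ihj (by omega) (n - 1 + 2) (by omega) (by push_cast at hw ⊢; omega)] at h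
        have hk0 : (k : ℂ) - (2 * j + 2 : ℕ) ≠ 0 := by
          rw [← Nat.cast_sub (by omega)]; exact Nat.cast_ne_zero.2 (by omega)
        rw [mul_zero, add_zero, sub_add_cancel] at h
        exact (mul_eq_zero.1 h).resolve_left hk0
    have heven : ∀ i : ℤ, 2 * i = w → ∀ j : ℕ, 2 * j ≤ k → j < i →
        ∃ p : ℝ, 0 < p ∧ L (2 * j) (i - j) = (-1) ^ j * p * L 0 i := by
      intro i hi j
      induction j with
      | zero => exact fun _ _ => ⟨1, one_pos, by simp⟩
      | succ j ihj =>
        intro hj hji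
        obtain ⟨p, hp, hpe⟩ := ihj (by omega) (by push_cast at hji; omega)
        have h := hN (2 * j + 1) (by omega) (i - j - 2) (by push_cast at hji; omega)
          (by push_cast; omega)
        have hc : (0 : ℝ) < k - (2 * j + 1) := by
          have : ((2 * (j + 1) : ℕ) : ℝ) ≤ k := Nat.cast_le.2 hj
          push_cast at this; linarith
        refine ⟨(2 * j + 1) * p / (k - (2 * j + 1)), by positivity, ?_⟩
        have hc' : (k : ℂ) - (2 * j + 1) ≠ 0 := by
          have := Complex.ofReal_ne_zero.2 hc.ne'
          push_cast at this; exact this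
        rw [show 2 * j + 1 - 1 = 2 * j by omega, show i - (j : ℤ) - 2 + 2 = i - j by ring, hpe,
          show i - (j : ℤ) - 2 + 1 = i - (j + 1 : ℕ) by push_cast; ring] at h
        push_cast at h ⊢
        apply mul_left_cancel₀ hc'
        field_simp
        rw [show 2 * (j + 1) = 2 * j + 1 + 1 by ring]
        linear_combination h
    have hzero : ∀ i : ℤ, 2 * i = w → L 0 i = 0 := by
      intro i hi
      rcases (show 0 ≤ i by omega).eq_or_lt with rfl | hi0
      · exact hL0 0 (by omega)
      by_cases him : i ≤ m
      · exact hLi i hi0 him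
      obtain ⟨t, rfl, rfl⟩ | ⟨t, rfl, rfl⟩ := hk
      · obtain ⟨p, hp, hpe⟩ := heven i hi t (by omega) (by push_cast at him; omega)
        have h := hN (2 * t + 1) le_rfl (i - t - 2) (by push_cast at him; omega)
          (by push_cast; omega)
        rw [show 2 * t + 1 - 1 = 2 * t by omega, show i - (t : ℤ) - 2 + 2 = i - t by ring, hpe,
          sub_self, zero_mul, zero_add] at h
        have hk0 : ((2 * t + 1 : ℕ) : ℂ) ≠ 0 := Nat.cast_ne_zero.2 (by omega)
        exact (by simpa [hp.ne'] using (mul_eq_zero.1 h).resolve_left hk0)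
      · have hcoef : ∀ j : ℕ, j ≤ t + 1 → ∃ p : ℝ, 0 < p ∧
            ((i - j : ℤ) : ℂ) * L (2 * j) (i - j) = ((i - j : ℤ) : ℂ) * ((-1) ^ j * p * L 0 i) := by
          intro j hj
          rcases (show (j : ℤ) ≤ i by omega).eq_or_lt with h | h
          · exact ⟨1, one_pos, by simp [← h]⟩
          · obtain ⟨p, hp, hpe⟩ := heven i hi j (by omega) h
            exact ⟨p, hp, by rw [hpe]⟩
        have hf : ∀ j : ℕ, j ≤ t → ∃ r : ℝ, 0 < r ∧
            L (2 * j + 1) (i - j + 1) = (-1) ^ (j + 1) * r * L 0 i := by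
          intro j
          induction j with
          | zero =>
            intro _
            have h := hrel 0 (by omega) i
            have hi0' : (0 : ℝ) < i := by exact_mod_cast hi0
            refine ⟨i / (2 * t + 2), by positivity, ?_⟩
            have hc : (2 * t + 2 : ℂ) ≠ 0 := by exact_mod_cast (show 2 * t + 2 ≠ 0 by omega)
            push_cast at h ⊢
            apply mul_left_cancel₀ hc
            field_simp
            simp only [sub_zero] at h ⊢
            linear_combination h
          | succ j ihj =>
            intro hj
            obtain ⟨r, hr, hre⟩ := ihj (by omega)
            obtain ⟨p, hp, hpe⟩ := hcoef (j + 1) (by omega)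
            have h := hrel (2 * (j + 1)) (by omega) (i - (j + 1 : ℕ))
            rw [show 2 * (j + 1) - 1 = 2 * j + 1 by omega, hpe,
              show i - ((j + 1 : ℕ) : ℤ) + 2 = i - j + 1 by push_cast; ring, hre] at h
            have hc : (0 : ℝ) < 2 * t + 2 - 2 * (j + 1) := by
              have : ((j + 1 : ℕ) : ℝ) ≤ t := Nat.cast_le.2 hj
              push_cast at this; linarith
            have hij : (0 : ℝ) < i - (j + 1) := by
              have : ((j + 1 : ℕ) : ℤ) < i := by omega
              have : (((j + 1 : ℕ) : ℤ) : ℝ) < i := Int.cast_lt.2 this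
              push_cast at this; linarith
            have hc' : (2 * t + 2 : ℂ) - 2 * (j + 1) ≠ 0 := by
              have := Complex.ofReal_ne_zero.2 hc.ne'
              push_cast at this; exact this
            refine ⟨((i - (j + 1)) * p + 2 * (j + 1) * r) / (2 * t + 2 - 2 * (j + 1)),
              by positivity, ?_⟩
            push_cast at h ⊢
            apply mul_left_cancel₀ hc'
            rw [mul_comm _ (L 0 i), mul_left_comm, mul_left_comm _ ((-1 : ℂ) ^ (j + 1 + 1)),
              mul_div_cancel₀ _ hc']
            linear_combination h
        obtain ⟨r, hr, hre⟩ := hf t le_rfl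
        obtain ⟨p, hp, hpe⟩ := hcoef (t + 1) le_rfl
        have h := hrel (2 * (t + 1)) (by omega) (i - (t + 1 : ℕ))
        rw [show 2 * (t + 1) - 1 = 2 * t + 1 by omega, hpe,
          show i - ((t + 1 : ℕ) : ℤ) + 2 = i - t + 1 by push_cast; ring, hre] at h
        have hit : (0 : ℝ) ≤ i - (t + 1) := by
          have : ((t + 1 : ℕ) : ℤ) ≤ i := by push_cast; omega
          have : (((t + 1 : ℕ) : ℤ) : ℝ) ≤ i := Int.cast_le.2 this
          push_cast at this; linarith
        have hpos : (i - (t + 1)) * p + 2 * (t + 1) * r ≠ 0 := by positivity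
        have hpos' := Complex.ofReal_ne_zero.2 hpos
        push_cast at h hpos'
        have h2 : ((-1 : ℂ) ^ (t + 1) * ((i - (t + 1)) * p + 2 * (t + 1) * r)) * L 0 i = 0 := by
          linear_combination h
        exact (mul_eq_zero.1 h2).resolve_left
          (mul_ne_zero (pow_ne_zero _ (by norm_num)) hpos')
    intro b hb n hn hw
    obtain ⟨j, rfl | rfl⟩ := b.even_or_odd'
    · rcases hn.eq_or_lt with rfl | hn
      · exact hL0 _ hb
      push_cast at hw
      obtain ⟨p, -, hpe⟩ := heven (n + j) (by linarith) j hb (by omega)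
      rw [hzero (n + j) (by linarith), mul_zero, add_sub_cancel_right] at hpe
      exact hpe
    · exact hodd j hb n hn (by push_cast at hw; omega)
  have neg : ∀ N : ℕ, ∀ b ≤ k, ∀ n : ℤ, -n ≤ N → L b n = 0 := by
    intro N
    induction N with
    | zero =>
      intro b hb n hn
      exact nonneg (2 * n + b).toNat b hb n (by omega) (by omega)
    | succ N ih =>
      intro b hb n hn
      by_cases hn' : -n ≤ N
      · exact ih b hb n hn'
      have h := hrel b hb n
      have h1 : ((k : ℂ) - b) * L (b + 1) (n + 1) = 0 := by
        rcases hb.eq_or_lt with rfl | hb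
        · simp
        · rw [ih (b + 1) hb (n + 1) (by omega), mul_zero]
      rw [h1, ih (b - 1) (by omega) (n + 2) (by omega), mul_zero, add_zero, add_zero] at h
      exact (mul_eq_zero.1 h).resolve_left (Int.cast_ne_zero.2 (by omega))
  exact fun b hb n => neg n.natAbs b hb n (by omega)

/-- If `θ_0 v`, with `v` having coefficients `V`, is a combination of the proposed basis elements,
its coefficients being `T`, then it vanishes. -/
theorem theta_coeff_eq_zero (k m : ℕ)
    (hk : (∃ t, k = 2 * t + 1 ∧ m = t + 1) ∨ ∃ t, k = 2 * t + 2 ∧ t = m)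
    (V T : ℕ → ℤ → ℂ) (M : ℕ) (hV : ∀ b n, k < b → V b n = 0)
    (hM : ∀ (b : ℕ) (n : ℤ), M < |n| → V b n = 0)
    (h0 : ∀ n : ℤ, n * V 0 n + V 1 (n - 2) = T 0 n)
    (hs : ∀ (b : ℕ) (n : ℤ),
      n * V (b + 1) n + ((k : ℂ) - b) * V b (n - 1) + (b + 2) * V (b + 2) (n - 2) = T (b + 1) n)
    (hT0 : ∀ n : ℤ, n ≠ 0 → ¬ (1 ≤ n ∧ n ≤ m) → T 0 n = 0)
    (hTs : ∀ (b : ℕ) (n : ℤ), n ≠ 0 → T (b + 1) n = 0) :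
    ∀ b n, T b n = 0 := by
  have neg' : ∀ N : ℕ, ∀ n : ℤ, n < 0 → n ≤ N - M - 1 → ∀ b, V b n = 0 := by
    intro N
    induction N with
    | zero => exact fun n hn hn' b => hM b n (by rw [abs_of_neg hn]; push_cast at hn'; omega)
    | succ N ih =>
      intro n hn hn' b
      push_cast at hn'
      have hn0 : (n : ℂ) ≠ 0 := Int.cast_ne_zero.2 hn.ne
      cases b with
      | zero =>
        have h := h0 n
        rw [hT0 n hn.ne (by omega), ih (n - 2) (by omega) (by omega), add_zero] at h
        exact (mul_eq_zero.1 h).resolve_left hn0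
      | succ b =>
        have h := hs b n
        rw [hTs b n hn.ne, ih (n - 2) (by omega) (by omega), ih (n - 1) (by omega) (by omega),
          mul_zero, mul_zero, add_zero, add_zero] at h
        exact (mul_eq_zero.1 h).resolve_left hn0
  have neg : ∀ (b : ℕ) (n : ℤ), n < 0 → V b n = 0 := fun b n hn => neg' M n hn (by omega) b
  replace hT0 : ∀ n : ℤ, ¬ (1 ≤ n ∧ n ≤ m) → T 0 n = 0 := by
    intro n hn
    by_cases h : n = 0
    · subst h; rw [← h0, neg 1 (0 - 2) (by omega)]; simp
    · exact hT0 n h hn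
  replace hTs : ∀ (b : ℕ) (n : ℤ), T (b + 1) n = 0 := by
    intro b n
    by_cases h : n = 0
    · subst h
      rw [← hs, neg b (0 - 1) (by omega), neg (b + 2) (0 - 2) (by omega)]; simp
    · exact hTs b n h
  have step : ∀ D : ℤ, (∀ (b : ℕ) (n : ℤ), D < 2 * n + b → V b n = 0) →
      ∀ (b : ℕ) (n : ℤ), 2 * n + b = D → V b n = 0 := by
    intro D hD
    have hN : ∀ (b : ℕ) (n : ℤ), 2 * n + b = D →
        ((k : ℂ) - b) * V b n + (b + 2) * V (b + 2) (n - 1) = 0 := by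
      intro b n hn
      have h := hs b (n + 1)
      rw [hTs, hD (b + 1) (n + 1) (by push_cast; omega), mul_zero, zero_add,
        add_sub_cancel_right, show n + 1 - 2 = n - 1 by ring] at h
      exact h
    by_cases hDk : D < k ∨ D % 2 ≠ k % 2
    · have down : ∀ s b : ℕ, k ≤ b + s → ∀ n : ℤ, 2 * n + b = D → V b n = 0 := by
        intro s
        induction s with
        | zero =>
          intro b hb n hn
          rcases hb.eq_or_lt with h | h
          · exact neg b n (by omega)
          · exact hV b n h
        | succ s ih =>
          intro b hb n hn
          by_cases hb' : k ≤ b + s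
          · exact ih b hb' n hn
          have h := hN b n hn
          rw [ih (b + 2) (by omega) (n - 1) (by push_cast; omega), mul_zero, add_zero] at h
          refine (mul_eq_zero.1 h).resolve_left ?_
          rw [← Nat.cast_sub (by omega)]; exact Nat.cast_ne_zero.2 (by omega)
      exact fun b n hn => down k b (by omega) n hn
    · push Not at hDk
      obtain ⟨hkD, hpar⟩ := hDk
      obtain ⟨t, rfl, rfl⟩ | ⟨t, rfl, rfl⟩ := hk
      · have up : ∀ j : ℕ, ∀ n : ℤ, 2 * n + (2 * j + 1) = D → V (2 * j + 1) n = 0 := by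
          intro j
          induction j with
          | zero =>
            intro n hn
            have h := h0 (n + 2)
            push_cast at hkD hn
            rw [hT0 _ (by push_cast; omega), hD 0 (n + 2) (by push_cast; omega), mul_zero,
              zero_add, add_sub_cancel_right] at h
            exact h
          | succ j ih =>
            intro n hn
            have h := hN (2 * j + 1) (n + 1) (by push_cast at hn ⊢; omega)
            rw [ih (n + 1) (by push_cast at hn ⊢; omega), mul_zero, zero_add,
              add_sub_cancel_right] at h
            refine (mul_eq_zero.1 h).resolve_left ?_
            exact_mod_cast (show 2 * j + 1 + 2 ≠ 0 by omega)
        intro b n hn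
        obtain ⟨j, rfl | rfl⟩ := b.even_or_odd'
        · push_cast at hn hpar; omega
        · exact up j n (by push_cast at hn; exact hn)
      · obtain ⟨i, rfl⟩ : ∃ i, D = 2 * i := ⟨D / 2, by push_cast at hpar; omega⟩
        push_cast at hkD
        have hx : ∀ j : ℕ, j ≤ t + 1 →
            ∃ p : ℝ, 0 < p ∧ V (2 * j) (i - j) = (-1) ^ j * p * V 0 i := by
          intro j
          induction j with
          | zero => exact fun _ => ⟨1, one_pos, by simp⟩
          | succ j ih =>
            intro hj
            obtain ⟨p, hp, hpe⟩ := ih (by omega)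
            have h := hN (2 * j) (i - j) (by push_cast; ring)
            have hc : (0 : ℝ) < 2 * t + 2 - 2 * j := by
              have : ((j + 1 : ℕ) : ℝ) ≤ (t + 1 : ℕ) := Nat.cast_le.2 hj
              push_cast at this; linarith
            refine ⟨(2 * t + 2 - 2 * j) * p / (2 * j + 2), by positivity, ?_⟩
            have hc' : (2 * j + 2 : ℂ) ≠ 0 := by exact_mod_cast (show 2 * j + 2 ≠ 0 by omega)
            rw [hpe, show i - (j : ℤ) - 1 = i - (j + 1 : ℕ) by push_cast; ring] at h
            push_cast at h ⊢
            apply mul_left_cancel₀ hc'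
            rw [mul_comm _ (V 0 i), mul_left_comm, mul_left_comm _ ((-1 : ℂ) ^ (j + 1)),
              mul_div_cancel₀ _ hc', show 2 * (j + 1) = 2 * j + 2 by ring]
            linear_combination h
        have hy : ∀ j : ℕ, j ≤ t →
            ∃ r : ℝ, 0 < r ∧ V (2 * j + 1) (i - j - 2) = (-1) ^ (j + 1) * r * V 0 i := by
          intro j
          induction j with
          | zero =>
            intro _
            have h := h0 i
            rw [hT0 i (by omega)] at h
            have hi : (0 : ℝ) < i := by exact_mod_cast (show 0 < i by omega)
            refine ⟨i, hi, ?_⟩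
            push_cast
            simp only [sub_zero]
            linear_combination h
          | succ j ih =>
            intro hj
            obtain ⟨r, hr, hre⟩ := ih (by omega)
            obtain ⟨p, hp, hpe⟩ := hx (j + 1) (by omega)
            have h := hs (2 * j + 1) (i - (j + 1 : ℕ))
            rw [hTs, show 2 * j + 1 + 1 = 2 * (j + 1) by ring, hpe,
              show i - ((j + 1 : ℕ) : ℤ) - 1 = i - j - 2 by push_cast; ring, hre] at h
            have hc : (0 : ℝ) < 2 * t + 2 - (2 * j + 1) := by
              have : ((j + 1 : ℕ) : ℝ) ≤ t := Nat.cast_le.2 hj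
              push_cast at this; linarith
            have hij : (0 : ℝ) < i - (j + 1) := by
              have : ((j + 1 : ℕ) : ℤ) < i := by omega
              have : (((j + 1 : ℕ) : ℤ) : ℝ) < i := Int.cast_lt.2 this
              push_cast at this; linarith
            have hc' : (2 * j + 3 : ℂ) ≠ 0 := by exact_mod_cast (show 2 * j + 3 ≠ 0 by omega)
            refine ⟨((i - (j + 1)) * p + (2 * t + 2 - (2 * j + 1)) * r) / (2 * j + 3),
              by positivity, ?_⟩
            push_cast at h ⊢
            apply mul_left_cancel₀ hc'
            rw [mul_comm _ (V 0 i), mul_left_comm, mul_left_comm _ ((-1 : ℂ) ^ (j + 1 + 1)),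
              mul_div_cancel₀ _ hc', show 2 * (j + 1) + 1 = 2 * j + 1 + 2 by ring]
            linear_combination h
        have hzero : V 0 i = 0 := by
          obtain ⟨r, hr, hre⟩ := hy t le_rfl
          obtain ⟨p, hp, hpe⟩ := hx (t + 1) le_rfl
          have h := hs (2 * t + 1) (i - (t + 1 : ℕ))
          rw [hTs, show 2 * t + 1 + 1 = 2 * (t + 1) by ring, hpe, hV (2 * t + 1 + 2) _ (by omega),
            show i - ((t + 1 : ℕ) : ℤ) - 1 = i - t - 2 by push_cast; ring, hre] at h
          have hit : (0 : ℝ) ≤ i - (t + 1) := by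
            have : ((t + 1 : ℕ) : ℤ) ≤ i := by push_cast; omega
            have : (((t + 1 : ℕ) : ℤ) : ℝ) ≤ i := Int.cast_le.2 this
            push_cast at this; linarith
          have hpos : (i - (t + 1)) * p + r ≠ 0 := by positivity
          have hpos' := Complex.ofReal_ne_zero.2 hpos
          push_cast at h hpos'
          have h2 : ((-1 : ℂ) ^ (t + 1) * ((i - (t + 1)) * p + r)) * V 0 i = 0 := by
            linear_combination h
          exact (mul_eq_zero.1 h2).resolve_left
            (mul_ne_zero (pow_ne_zero _ (by norm_num)) hpos')
        intro b n hn
        obtain ⟨j, rfl | rfl⟩ := b.even_or_odd'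
        · by_cases hj : j ≤ t + 1
          · obtain ⟨p, -, hpe⟩ := hx j hj
            push_cast at hn
            rw [hzero, mul_zero, show i - (j : ℤ) = n by omega] at hpe
            exact hpe
          · exact hV _ _ (by omega)
        · push_cast at hn; omega
  have vanish : ∀ s : ℕ, ∀ (b : ℕ) (n : ℤ), 2 * (M : ℤ) + k - s < 2 * n + b → V b n = 0 := by
    intro s
    induction s with
    | zero =>
      intro b n hn
      by_cases hb : k < b
      · exact hV b n hb
      · have := le_abs_self n
        exact hM b n (by push_cast at hn; omega)
    | succ s ih =>
      intro b n hn
      by_cases h : 2 * (M : ℤ) + k - s < 2 * n + b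
      · exact ih b n h
      · exact step _ ih b n (by push_cast at hn; omega)
  have hVz : ∀ b n, V b n = 0 := by
    intro b n
    exact vanish (2 * M + k + 1 + 2 * n.natAbs) b n (by omega)
  intro b n
  cases b with
  | zero => simp [← h0, hVz]
  | succ b => simp [← hs, hVz]

theorem zdz_apply (p : ℤ →₀ ℂ) (n : ℤ) : zdz p n = n * p n := by
  induction p using Finsupp.induction_linear with
  | zero => simp
  | add p q hp hq => rw [map_add, Finsupp.add_apply, hp, hq, Finsupp.add_apply, mul_add]
  | single a c =>
    by_cases h : a = n
    · subst h; simp [zdz]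
    · simp [zdz, h]

theorem shiftT_apply (m : ℤ) (p : ℤ →₀ ℂ) (n : ℤ) : shiftT m p n = p (n - m) := by
  have h := Finsupp.mapDomain_apply (add_left_injective m) p (n - m)
  simpa [shiftT] using h

theorem theta_apply (k : ℕ) (v : Fin (k + 1) → (ℤ →₀ ℂ)) (b : Fin (k + 1)) (n : ℤ) :
    theta k 0 v b n = n * v b n
      + (if 1 ≤ (b : ℕ) then ((k - ((b : ℕ) - 1) : ℕ) : ℂ) *
          v ⟨(b : ℕ) - 1, by have := b.isLt; omega⟩ (n - 1) else 0)
      + (if h : (b : ℕ) + 1 ≤ k then (((b : ℕ) + 1 : ℕ) : ℂ) *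
          v ⟨(b : ℕ) + 1, by omega⟩ (n - 2) else 0) := by
  simp only [theta, LinearMap.pi_apply, zero_smul, add_zero, LinearMap.add_apply,
    Finsupp.add_apply]
  congr 1
  · congr 1
    · simp [zdz_apply]
    · split_ifs <;> simp [shiftT_apply]
  · split_ifs <;> simp [shiftT_apply]

/-- The coefficient of `zⁿ·u_b` in `v`, which is zero for `b > k`. -/
noncomputable def coeffL (k : ℕ) (v : Fin (k + 1) → (ℤ →₀ ℂ)) (b : ℕ) (n : ℤ) : ℂ :=
  if h : b < k + 1 then v ⟨b, h⟩ n else 0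

theorem coeffL_theta_zero (k : ℕ) (v : Fin (k + 1) → (ℤ →₀ ℂ)) (n : ℤ) :
    n * coeffL k v 0 n + coeffL k v 1 (n - 2) = coeffL k (theta k 0 v) 0 n := by
  by_cases h : 1 ≤ k
  · simp [coeffL, theta_apply, h, show 0 < k from h]
  · simp [coeffL, theta_apply, show k = 0 by omega]

theorem coeffL_theta_succ (k : ℕ) (v : Fin (k + 1) → (ℤ →₀ ℂ)) (b : ℕ) (n : ℤ) :
    n * coeffL k v (b + 1) n + ((k : ℂ) - b) * coeffL k v b (n - 1)
      + (b + 2) * coeffL k v (b + 2) (n - 2) = coeffL k (theta k 0 v) (b + 1) n := by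
  rcases lt_trichotomy b k with h | rfl | h
  · by_cases h2 : b + 2 ≤ k
    · simp [coeffL, theta_apply, h, show b < k + 1 by omega, show b + 2 < k + 1 by omega,
        show b + 1 + 1 ≤ k by omega, Nat.cast_sub h.le]
      left
      ring
    · simp [coeffL, theta_apply, h, show b < k + 1 by omega, show ¬ b + 2 < k + 1 by omega,
        show ¬ b + 1 + 1 ≤ k by omega, Nat.cast_sub h.le]
  · simp [coeffL]
  · simp [coeffL, show ¬ b < k by omega, show ¬ b < k + 1 by omega,
      show ¬ b + 2 < k + 1 by omega]

/-- The monomial `zⁿ·u_b`, which is zero for `b > k`. -/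
noncomputable def monoL (k b : ℕ) (n : ℤ) : Fin (k + 1) → (ℤ →₀ ℂ) :=
  if h : b < k + 1 then eL k ⟨b, h⟩ (Finsupp.single n 1) else 0

theorem coeffL_ext (k : ℕ) {v w : Fin (k + 1) → (ℤ →₀ ℂ)}
    (h : ∀ b n, coeffL k v b n = coeffL k w b n) : v = w := by
  ext b n
  simpa only [coeffL, Fin.is_lt, dif_pos] using h b n

theorem coeffL_add (k : ℕ) (v w : Fin (k + 1) → (ℤ →₀ ℂ)) (b : ℕ) (n : ℤ) :
    coeffL k (v + w) b n = coeffL k v b n + coeffL k w b n := by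
  unfold coeffL; split_ifs <;> simp

theorem coeffL_smul (k : ℕ) (c : ℂ) (v : Fin (k + 1) → (ℤ →₀ ℂ)) (b : ℕ) (n : ℤ) :
    coeffL k (c • v) b n = c * coeffL k v b n := by
  unfold coeffL; split_ifs <;> simp

theorem coeffL_sum (k : ℕ) {ι : Type*} (s : Finset ι) (f : ι → Fin (k + 1) → (ℤ →₀ ℂ)) (b : ℕ)
    (n : ℤ) : coeffL k (∑ i ∈ s, f i) b n = ∑ i ∈ s, coeffL k (f i) b n := by
  unfold coeffL; split_ifs <;> simp

theorem coeffL_eL (k : ℕ) (a : Fin (k + 1)) (m : ℤ) (b : ℕ) (n : ℤ) :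
    coeffL k (eL k a (Finsupp.single m 1)) b n = if b = a ∧ n = m then 1 else 0 := by
  unfold coeffL eL
  by_cases hb : b < k + 1
  · by_cases hba : b = a
    · subst hba; simp only [Fin.is_lt, dif_pos, if_true, Finsupp.single_apply, true_and, eq_comm]
    · simp [hba, Fin.ext_iff]
  · simp [hb, show b ≠ a by have := a.isLt; omega]

theorem coeffL_monoL (k a : ℕ) (m : ℤ) (b : ℕ) (n : ℤ) :
    coeffL k (monoL k a m) b n = if a ≤ k ∧ b = a ∧ n = m then 1 else 0 := by
  unfold monoL
  split_ifs with h h' h'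
  · rw [coeffL_eL, if_pos ⟨h'.2.1, h'.2.2⟩]
  · rw [coeffL_eL, if_neg]
    exact fun h2 => h' ⟨by omega, h2.1, h2.2⟩
  · omega
  · simp [coeffL]

theorem theta_monoL (k a : ℕ) (ha : a ≤ k) (n : ℤ) :
    theta k 0 (monoL k a n) = (n : ℂ) • monoL k a n
      + ((k : ℂ) - a) • monoL k (a + 1) (n + 1) + (a : ℂ) • monoL k (a - 1) (n + 2) := by
  apply coeffL_ext
  intro b l
  have h0 : a = 0 → (a : ℂ) = 0 := fun h => by exact_mod_cast h
  cases b with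
  | zero =>
    simp only [← coeffL_theta_zero, coeffL_add, coeffL_smul, coeffL_monoL]
    have h1 : 1 = a → (1 : ℂ) = a := fun h => by exact_mod_cast h
    grind
  | succ b =>
    simp only [← coeffL_theta_succ, coeffL_add, coeffL_smul, coeffL_monoL]
    have h1 : b = a → (b : ℂ) = a := congrArg _
    have h2 : b + 2 = a → (b : ℂ) + 2 = a := fun h => by exact_mod_cast h
    have h3 : k = a → (k : ℂ) = a := congrArg _
    grind

theorem linearMap_eq_zero_of_monoL (k : ℕ) (f : (Fin (k + 1) → (ℤ →₀ ℂ)) →ₗ[ℂ] ℂ)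
    (h : ∀ b ≤ k, ∀ n, f (monoL k b n) = 0) : f = 0 := by
  refine LinearMap.pi_ext' fun b => Finsupp.lhom_ext' fun n => LinearMap.ext_ring ?_
  have hb : monoL k b n = Pi.single b (Finsupp.single n 1) := by
    ext c l
    simp only [monoL, Fin.is_lt, dif_pos, eL, Pi.single_apply]
  have := h b (by omega) n
  rw [hb] at this
  simpa using this

theorem linearIndependent_famL (k m : ℕ)
    (hk : (∃ t, k = 2 * t + 1 ∧ m = t + 1) ∨ ∃ t, k = 2 * t + 2 ∧ t = m) :
    LinearIndependent ℂ (famL k m 0) := by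
  rw [Fintype.linearIndependent_iff]
  intro g hg
  set w : Fin (k + 1) → (ℤ →₀ ℂ) :=
    ∑ i : Fin m, g (.inl i) • eL k 0 (Finsupp.single ((i : ℕ) + 1 : ℤ) 1)
      + ∑ j, g (.inr j) • eL k j (Finsupp.single 0 1) with hw
  have hmk : (LinearMap.range (theta k 0)).mkQ w = 0 := by
    simp only [← hg, Fintype.sum_sum_type, hw, map_add, map_sum, map_smul]
    rfl
  rw [Submodule.mkQ_apply, Submodule.Quotient.mk_eq_zero] at hmk
  obtain ⟨v, hv⟩ := hmk
  have hT : ∀ b n, coeffL k w b n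
      = ∑ i : Fin m, g (.inl i) * (if b = 0 ∧ n = (i : ℕ) + 1 then 1 else 0)
        + ∑ j : Fin (k + 1), g (.inr j) * (if b = j ∧ n = 0 then 1 else 0) := by
    intro b n
    simp only [hw, coeffL_add, coeffL_sum, coeffL_smul, coeffL_eL]
    rfl
  obtain ⟨M, hM⟩ : ∃ M : ℕ, ∀ (b : ℕ) (n : ℤ), M < |n| → coeffL k v b n = 0 := by
    refine ⟨∑ b, ∑ n ∈ (v b).support, n.natAbs, fun b n hn => ?_⟩
    by_contra h
    unfold coeffL at h
    split_ifs at h with hb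
    · have h1 : n.natAbs ≤ ∑ n ∈ (v ⟨b, hb⟩).support, n.natAbs :=
        Finset.single_le_sum (f := fun n : ℤ => n.natAbs) (fun _ _ => Nat.zero_le _)
          (Finsupp.mem_support_iff.2 h)
      have h2 : ∑ n ∈ (v ⟨b, hb⟩).support, n.natAbs ≤ ∑ b, ∑ n ∈ (v b).support, n.natAbs :=
        Finset.single_le_sum (f := fun b => ∑ n ∈ (v b).support, n.natAbs)
          (fun _ _ => Nat.zero_le _) (Finset.mem_univ _)
      rw [Int.abs_eq_natAbs] at hn
      omega
    · exact h rfl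
  have key := theta_coeff_eq_zero k m hk (coeffL k v) (coeffL k w) M
    (fun b n hb => by simp [coeffL, show ¬ b < k + 1 by omega]) hM
    (fun n => by rw [coeffL_theta_zero, hv]) (fun b n => by rw [coeffL_theta_succ, hv])
    (fun n hn hnm => by
      rw [hT]
      simp only [hn, and_false, if_false, mul_zero, Finset.sum_const_zero, add_zero]
      refine Finset.sum_eq_zero fun i _ => ?_
      rw [if_neg (by have := i.isLt; omega), mul_zero])
    (fun b n hn => by rw [hT]; simp [hn])
  rintro (i | j)
  · have h := key 0 ((i : ℕ) + 1)
    rw [hT, Finset.sum_eq_single i (by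
        intro i' _ hi'
        rw [if_neg (by rw [Ne, Fin.ext_iff] at hi'; omega), mul_zero]) (by simp),
      Finset.sum_eq_zero (fun j _ => by rw [if_neg (by omega), mul_zero])] at h
    simpa using h
  · have h := key j 0
    rw [hT, Finset.sum_eq_zero (fun i _ => by rw [if_neg (by omega), mul_zero]),
      Finset.sum_eq_single j (by
        intro j' _ hj'
        rw [if_neg (by rw [Ne, Fin.ext_iff] at hj'; omega), mul_zero]) (by simp)] at h
    simpa using h

theorem span_famL_eq_top (k m : ℕ)
    (hk : (∃ t, k = 2 * t + 1 ∧ m = t + 1) ∨ ∃ t, k = 2 * t + 2 ∧ t = m) :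
    Submodule.span ℂ (Set.range (famL k m 0)) = ⊤ := by
  by_contra hne
  obtain ⟨f, hf, hle⟩ := Submodule.exists_le_ker_of_lt_top _ (lt_top_iff_ne_top.2 hne)
  have hfam : ∀ x, f (famL k m 0 x) = 0 := fun x =>
    hle (Submodule.subset_span (Set.mem_range_self x))
  set F := f.comp (LinearMap.range (theta k 0)).mkQ with hF
  have hFθ : ∀ v, F (theta k 0 v) = 0 := by
    intro v
    rw [hF, LinearMap.comp_apply, Submodule.mkQ_apply,
      (Submodule.Quotient.mk_eq_zero _).2 (LinearMap.mem_range_self _ v), map_zero]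
  have hF0 : F = 0 := by
    refine linearMap_eq_zero_of_monoL k F
      (dual_family_eq_zero k m hk (fun b n => F (monoL k b n)) ?_ ?_ ?_)
    · intro a ha n
      have h := hFθ (monoL k a n)
      rw [theta_monoL k a ha] at h
      simpa only [map_add, map_smul, smul_eq_mul] using h
    · intro j hj
      have h := hfam (.inr ⟨j, by omega⟩)
      simpa [monoL, show j < k + 1 by omega, famL, hF] using h
    · intro i hi him
      have h := hfam (.inl ⟨(i - 1).toNat, by omega⟩)
      have hi' : (((i - 1).toNat : ℕ) : ℤ) + 1 = i := by omega
      simp only [famL, Sum.elim_inl, hi'] at h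
      exact h
  apply hf
  exact LinearMap.ext fun x => x.induction_on fun v => LinearMap.congr_fun hF0 v

/-- For `ρ = 0`, the classes of `ω_i = z^{i−1}u_0 dz` (`i ∈ I_k`) and `η_j = u_j dz/z`
(`0 ≤ j ≤ k`), i.e. the classes of the elements `z^i·u_0` (`i ∈ I_k`) and `u_j`
(`0 ≤ j ≤ k`), form a `ℂ`-basis of `H¹_dR(𝔾_m, Sym^k Ai) = coker(θ_0 : Λ_0 → Λ_0)`,
where `I_k = {1,…,k′+1}` for `k` odd and `I_k = {1,…,k′}` for `k` even. -/
theorem stmt_12 (k k' : ℕ) (hk : 1 ≤ k) (hk' : k' = (k - 1) / 2) :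
    LinearIndependent ℂ (famL k (if Odd k then k' + 1 else k') 0)
    ∧ Submodule.span ℂ (Set.range (famL k (if Odd k then k' + 1 else k') 0)) = ⊤ := by
  have h : (∃ t, k = 2 * t + 1 ∧ (if Odd k then k' + 1 else k') = t + 1) ∨
      ∃ t, k = 2 * t + 2 ∧ t = (if Odd k then k' + 1 else k') := by
    by_cases hodd : Odd k
    · obtain ⟨t, ht⟩ := id hodd
      exact Or.inl ⟨t, ht, by rw [if_pos hodd]; omega⟩
    · obtain ⟨t, ht⟩ := Nat.not_odd_iff_even.1 hodd
      exact Or.inr ⟨t - 1, by omega, by rw [if_neg hodd]; omega⟩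
  exact ⟨linearIndependent_famL k _ h, span_famL_eq_top k _ h⟩
end

section
/- The classes of the elements z^{i−1}·u_0 for i ∈ I_k form a ℂ-basis of coker(∇ : Λ_0⁺ → Λ_0⁺) = H^1_dR(𝔸¹, Sym^k Ai), where I_k = {1, …, k′+1} if k is odd and I_k = {1, …, k′} if k is even. In particular dim_ℂ H^1_dR(𝔸¹, Sym^k Ai) = k′+1 if k is odd and k′ if k is even. -/
open Polynomial

/-- The operator `z∂_z` on `Λ_ρ⁺ = ⊕_{a=0}^k ℂ[z]·u_a`, the polynomial lattice in the module of
global sections of `V_ρ` over `𝔾_m` (where `V_0 = Sym^k Ai`, `V_{1/2} = L ⊗ Sym^k Ai`):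
`θ_ρ(p·u_a) = z·p′·u_a + p·(ρ·u_a + (k−a)·z·u_{a+1} + a·z²·u_{a−1})`. -/
noncomputable def thetaP (k : ℕ) (ρ : ℂ) :
    (Fin (k + 1) → Polynomial ℂ) →ₗ[ℂ] (Fin (k + 1) → Polynomial ℂ) :=
  LinearMap.pi fun b =>
    (LinearMap.mulLeft ℂ (X : Polynomial ℂ)).comp
        ((Polynomial.derivative).comp (LinearMap.proj b))
    + ρ • LinearMap.proj b
    + (if 1 ≤ (b : ℕ) then
        ((k - ((b : ℕ) - 1) : ℕ) : ℂ) • (LinearMap.mulLeft ℂ (X : Polynomial ℂ)).comp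
          (LinearMap.proj ⟨(b : ℕ) - 1, by have := b.isLt; omega⟩)
      else 0)
    + (if h : (b : ℕ) + 1 ≤ k then
        (((b : ℕ) + 1 : ℕ) : ℂ) • (LinearMap.mulLeft ℂ ((X : Polynomial ℂ) ^ 2)).comp
          (LinearMap.proj ⟨(b : ℕ) + 1, by omega⟩)
      else 0)

/-- The basis element `p·u_a` of `Λ_ρ⁺`. -/
noncomputable def eP (k : ℕ) (a : Fin (k + 1)) (p : Polynomial ℂ) :
    Fin (k + 1) → Polynomial ℂ :=
  fun b => if b = a then p else 0

/-- The action of `∂_z` on `Λ_0⁺`, the module of global sections of `Sym^k Ai` over `𝔸¹`: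
`∇(p·u_a) = p′·u_a + p·((k−a)·u_{a+1} + a·z·u_{a−1})`. -/
noncomputable def nablaP (k : ℕ) :
    (Fin (k + 1) → Polynomial ℂ) →ₗ[ℂ] (Fin (k + 1) → Polynomial ℂ) :=
  LinearMap.pi fun b =>
    (Polynomial.derivative).comp (LinearMap.proj b)
    + (if 1 ≤ (b : ℕ) then
        ((k - ((b : ℕ) - 1) : ℕ) : ℂ) •
          LinearMap.proj (R := ℂ) (φ := fun _ : Fin (k + 1) => Polynomial ℂ)
            ⟨(b : ℕ) - 1, by have := b.isLt; omega⟩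
      else 0)
    + (if h : (b : ℕ) + 1 ≤ k then
        (((b : ℕ) + 1 : ℕ) : ℂ) • (LinearMap.mulLeft ℂ (X : Polynomial ℂ)).comp
          (LinearMap.proj ⟨(b : ℕ) + 1, by omega⟩)
      else 0)

/-- The family of classes `u_0, z·u_0, …, z^{m−1}·u_0` in `coker(∇ : Λ_0⁺ → Λ_0⁺)`. -/
noncomputable def fam14 (k m : ℕ) :
    Fin m → ((Fin (k + 1) → Polynomial ℂ) ⧸ LinearMap.range (nablaP k)) :=
  fun i => Submodule.Quotient.mk (eP k 0 (X ^ (i : ℕ)))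

/-- The operators `C_a` on `ℂ[z]` given by `C_0 = 1`, `C_1 = ∂_z` and
`C_{a+1} = C_a ∂_z - a (k + 1 - a) C_{a-1} z`. Up to a nonzero scalar, the class of `p·u_a` in
`coker ∇` is that of `C_a(p)·u_0` for `a ≤ k`. -/
noncomputable def cyclicOp (k : ℕ) : ℕ → (ℂ[X] →ₗ[ℂ] ℂ[X])
  | 0 => LinearMap.id
  | 1 => derivative
  | a + 2 => (cyclicOp k (a + 1)).comp derivative
      - (((a + 1) * (k - a) : ℕ) : ℂ) • (cyclicOp k a).comp (LinearMap.mulLeft ℂ X)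

lemma cyclicOp_zero (k : ℕ) (p : ℂ[X]) : cyclicOp k 0 p = p := by
  simp [cyclicOp]

lemma cyclicOp_one (k : ℕ) (p : ℂ[X]) : cyclicOp k 1 p = derivative p := by
  simp [cyclicOp]

lemma cyclicOp_add_two (k a : ℕ) (p : ℂ[X]) :
    cyclicOp k (a + 2) p = cyclicOp k (a + 1) (derivative p)
      - (((a + 1) * (k - a) : ℕ) : ℂ) • cyclicOp k a (X * p) := by
  simp [cyclicOp]

lemma coeff_cyclicOp_add_two_X_pow (k a i j : ℕ) :
    (cyclicOp k (a + 2) (X ^ i)).coeff j = i * (cyclicOp k (a + 1) (X ^ (i - 1))).coeff j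
      - (((a + 1) * (k - a) : ℕ) : ℂ) * (cyclicOp k a (X ^ (i + 1))).coeff j := by
  have h : derivative (X ^ i : ℂ[X]) = (i : ℂ) • X ^ (i - 1) := by
    rw [derivative_X_pow, smul_eq_C_mul]
  rw [cyclicOp_add_two, h, map_smul, ← pow_succ']
  simp only [coeff_sub, coeff_smul, smul_eq_mul]

/-- The leading terms of `C_{2n}(z^i)` and `C_{2n+1}(z^i)`: the former has degree `i + n`, the
latter degree `i + n - 1`, and both leading coefficients have sign `(-1)^n`. -/
lemma coeff_cyclicOp_X_pow (k n : ℕ) :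
    (∀ i j, i + n < j → (cyclicOp k (2 * n) (X ^ i)).coeff j = 0) ∧
    (2 * n ≤ k + 1 → ∀ i, ∃ c : ℕ, 0 < c ∧
      (cyclicOp k (2 * n) (X ^ i)).coeff (i + n) = (-1) ^ n * c) ∧
    (∀ i j, i + n < j + 1 → (cyclicOp k (2 * n + 1) (X ^ i)).coeff j = 0) ∧
    (2 * n ≤ k → ∀ i j, i + n = j + 1 → ∃ c : ℕ, 0 < c ∧
      (cyclicOp k (2 * n + 1) (X ^ i)).coeff j = (-1) ^ n * c) := by
  induction n with
  | zero =>
    refine ⟨fun i j h => ?_, fun _ i => ⟨1, one_pos, ?_⟩, fun i j h => ?_, fun _ i j h => ?_⟩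
    · rw [cyclicOp_zero, coeff_X_pow, if_neg (by omega)]
    · simp [cyclicOp_zero]
    · rw [mul_zero, zero_add, cyclicOp_one, coeff_derivative, coeff_X_pow, if_neg (by omega),
        zero_mul]
    · refine ⟨i, by omega, ?_⟩
      have hi : i = j + 1 := by omega
      subst hi
      rw [cyclicOp_one, coeff_derivative, coeff_X_pow_self]
      push_cast
      ring
  | succ n ih =>
    obtain ⟨ih₀, ih₁, ih₂, ih₃⟩ := ih
    have h₀ : ∀ i j, i + (n + 1) < j → (cyclicOp k (2 * n + 2) (X ^ i)).coeff j = 0 := by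
      intro i j h
      rw [coeff_cyclicOp_add_two_X_pow, ih₂ _ _ (by omega), ih₀ _ _ (by omega)]
      simp
    have h₁ : 2 * n + 2 ≤ k + 1 → ∀ i, ∃ c : ℕ, 0 < c ∧
        (cyclicOp k (2 * n + 2) (X ^ i)).coeff (i + (n + 1)) = (-1) ^ (n + 1) * c := by
      intro hk i
      obtain ⟨c, hc, hce⟩ := ih₁ (by omega) (i + 1)
      have hkn : 0 < k - 2 * n := by omega
      refine ⟨(2 * n + 1) * (k - 2 * n) * c, by positivity, ?_⟩
      rw [coeff_cyclicOp_add_two_X_pow, ih₂ _ _ (by omega),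
        show i + (n + 1) = i + 1 + n by omega, hce]
      push_cast
      ring
    refine ⟨h₀, h₁, fun i j h => ?_, fun hk i j h => ?_⟩
    · rw [show 2 * (n + 1) + 1 = 2 * n + 1 + 2 by ring, coeff_cyclicOp_add_two_X_pow,
        ih₂ _ _ (by omega)]
      rcases Nat.eq_zero_or_pos i with rfl | hi
      · simp
      · rw [h₀ _ _ (by omega)]
        simp
    · obtain ⟨c, hc, hce⟩ := ih₃ (by omega) (i + 1) j (by omega)
      have hkn : 0 < k - (2 * n + 1) := by omega
      have hpos : 0 < (2 * n + 1 + 1) * (k - (2 * n + 1)) * c := by positivity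
      rw [show 2 * (n + 1) + 1 = 2 * n + 1 + 2 by ring, coeff_cyclicOp_add_two_X_pow, hce]
      rcases Nat.eq_zero_or_pos i with rfl | hi
      · refine ⟨_, hpos, ?_⟩
        push_cast
        ring
      · obtain ⟨d, -, hde⟩ := h₁ (by omega) (i - 1)
        rw [show i - 1 + (n + 1) = j by omega] at hde
        refine ⟨i * d + (2 * n + 1 + 1) * (k - (2 * n + 1)) * c, by omega, ?_⟩
        rw [hde]
        push_cast
        ring

section RaisesDegree

variable {K : Type*} [Field K] {L : K[X] →ₗ[K] K[X]} {m : ℕ}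

/-- A linear operator raising the degree of every monomial by exactly `m` has no nonzero
polynomial of degree less than `m` in its range. -/
lemma eq_zero_of_mem_range_of_degree_lt
    (hlt : ∀ i j, i + m < j → (L (X ^ i)).coeff j = 0)
    (hne : ∀ i, (L (X ^ i)).coeff (i + m) ≠ 0)
    {p : K[X]} (hp : p ∈ LinearMap.range L) (hdeg : ∀ j, m ≤ j → p.coeff j = 0) : p = 0 := by
  obtain ⟨g, rfl⟩ := hp
  suffices hg : g = 0 by rw [hg, map_zero]
  by_contra hg
  have h := hdeg (g.natDegree + m) (by omega)
  rw [congrArg L g.as_sum_range_C_mul_X_pow] at h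
  simp only [← smul_eq_C_mul, map_sum, map_smul, finsetSum_coeff, coeff_smul, smul_eq_mul] at h
  rw [Finset.sum_range_succ, Finset.sum_eq_zero, zero_add] at h
  · exact mul_ne_zero (leadingCoeff_ne_zero.mpr hg) (hne _) h
  · intro i hi
    rw [hlt _ _ (by have := Finset.mem_range.mp hi; omega), mul_zero]

/-- The monomials of degree less than `m` span a complement of the range of a linear operator
raising the degree of every monomial by exactly `m`. -/
lemma span_X_pow_sup_range_eq_top
    (hlt : ∀ i j, i + m < j → (L (X ^ i)).coeff j = 0)
    (hne : ∀ i, (L (X ^ i)).coeff (i + m) ≠ 0) :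
    Submodule.span K (Set.range fun i : Fin m => (X ^ (i : ℕ) : K[X])) ⊔ LinearMap.range L
      = ⊤ := by
  set S := Submodule.span K (Set.range fun i : Fin m => (X ^ (i : ℕ) : K[X])) ⊔ LinearMap.range L
  have hX : ∀ n, (X ^ n : K[X]) ∈ S := by
    intro n
    induction n using Nat.strong_induction_on with
    | _ n ih =>
      rcases lt_or_ge n m with hn | hn
      · exact Submodule.mem_sup_left (Submodule.subset_span ⟨⟨n, hn⟩, rfl⟩)
      · obtain ⟨i, rfl⟩ := Nat.exists_eq_add_of_le' hn
        have hL : L (X ^ i) ∈ S := Submodule.mem_sup_right ⟨_, rfl⟩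
        rw [(L (X ^ i)).as_sum_range' (i + m + 1)
          (Nat.lt_succ_of_le (natDegree_le_iff_coeff_eq_zero.mpr fun j hj => hlt i j hj)),
          Finset.sum_range_succ] at hL
        simp only [← C_mul_X_pow_eq_monomial, ← smul_eq_C_mul] at hL
        rw [Submodule.add_mem_iff_right _ (Submodule.sum_mem _ fun j hj =>
          S.smul_mem _ (ih j (Finset.mem_range.mp hj)))] at hL
        exact (S.smul_mem_iff (hne i)).mp hL
  refine eq_top_iff.mpr fun p _ => ?_
  rw [p.as_sum_range_C_mul_X_pow]
  simp only [← smul_eq_C_mul]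
  exact S.sum_mem fun j _ => S.smul_mem _ (hX j)

end RaisesDegree

/-- The element `p·u_a` for a natural number `a`, with the convention `u_a = 0` for `a > k`. -/
noncomputable def natBasisElt (k a : ℕ) : ℂ[X] →ₗ[ℂ] (Fin (k + 1) → ℂ[X]) :=
  LinearMap.pi fun b => if (b : ℕ) = a then LinearMap.id else 0

lemma natBasisElt_apply (k a : ℕ) (p : ℂ[X]) (b : Fin (k + 1)) :
    natBasisElt k a p b = if (b : ℕ) = a then p else 0 := by
  simp only [natBasisElt, LinearMap.pi_apply]
  split_ifs <;> rfl

lemma eP_zero_eq (k : ℕ) (p : ℂ[X]) : eP k 0 p = natBasisElt k 0 p := by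
  funext b
  simp only [eP, natBasisElt_apply, Fin.ext_iff, Fin.val_zero]

lemma natBasisElt_eq_zero {k a : ℕ} (h : k < a) (p : ℂ[X]) : natBasisElt k a p = 0 := by
  funext b
  rw [natBasisElt_apply, if_neg (by omega), Pi.zero_apply]

lemma sum_natBasisElt (k : ℕ) (f : Fin (k + 1) → ℂ[X]) :
    ∑ a : Fin (k + 1), natBasisElt k a (f a) = f := by
  funext b
  simp [Finset.sum_apply, natBasisElt_apply, ← Fin.ext_iff]

lemma nablaP_apply (k : ℕ) (f : Fin (k + 1) → ℂ[X]) (b : Fin (k + 1)) :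
    nablaP k f b = derivative (f b)
      + (if 1 ≤ (b : ℕ) then ((k - ((b : ℕ) - 1) : ℕ) : ℂ) • f ⟨b - 1, by omega⟩ else 0)
      + (if h : (b : ℕ) + 1 ≤ k then
          (((b : ℕ) + 1 : ℕ) : ℂ) • (X * f ⟨b + 1, by omega⟩) else 0) := by
  simp only [nablaP, LinearMap.pi_apply, LinearMap.add_apply]
  congr 1
  · congr 1
    split_ifs <;> rfl
  · split_ifs <;> rfl

lemma nablaP_natBasisElt {k a : ℕ} (h : a ≤ k) (p : ℂ[X]) :
    nablaP k (natBasisElt k a p) = natBasisElt k a (derivative p)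
      + ((k - a : ℕ) : ℂ) • natBasisElt k (a + 1) p
      + (a : ℂ) • natBasisElt k (a - 1) (X * p) := by
  funext ⟨b, hb⟩
  have h₁ : derivative (if b = a then p else 0) = if b = a then derivative p else 0 := by
    split_ifs <;> simp
  have h₂ : (if 1 ≤ b then ((k - (b - 1) : ℕ) : ℂ) • (if b - 1 = a then p else 0) else 0)
      = ((k - a : ℕ) : ℂ) • (if b = a + 1 then p else 0) := by
    rcases Nat.eq_zero_or_pos b with rfl | hb
    · simp
    · rw [if_pos (show 1 ≤ b from hb)]
      by_cases hba : b = a + 1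
      · subst hba; simp
      · rw [if_neg (by omega), if_neg hba, smul_zero, smul_zero]
  have h₃ : (if b + 1 ≤ k then ((b + 1 : ℕ) : ℂ) • (X * (if b + 1 = a then p else 0)) else 0)
      = (a : ℂ) • (if b = a - 1 then X * p else 0) := by
    rcases Nat.eq_zero_or_pos a with rfl | ha
    · simp
    · by_cases hba : b + 1 = a
      · subst hba
        simp [h]
      · rw [if_neg hba, if_neg (show ¬ b = a - 1 by omega), mul_zero, smul_zero, smul_zero, ite_self]
  simp only [Pi.add_apply, Pi.smul_apply, natBasisElt_apply]
  rw [← h₁, ← h₂, ← h₃, nablaP_apply]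
  simp only [natBasisElt_apply]
  rfl

/-- The map `Σ_a p_a·u_a ↦ Σ_a (-1)^a (k-a)! C_a(p_a)`, which identifies `coker ∇` with the
cokernel of the scalar operator `C_{k+1}`. -/
noncomputable def cyclicProj (k : ℕ) : (Fin (k + 1) → ℂ[X]) →ₗ[ℂ] ℂ[X] :=
  ∑ a : Fin (k + 1), ((-1) ^ (a : ℕ) * ((k - a).factorial : ℂ)) •
    (cyclicOp k a).comp (LinearMap.proj a)

lemma cyclicProj_natBasisElt {k a : ℕ} (h : a ≤ k) (p : ℂ[X]) :
    cyclicProj k (natBasisElt k a p)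
      = ((-1) ^ a * ((k - a).factorial : ℂ)) • cyclicOp k a p := by
  rw [cyclicProj, LinearMap.sum_apply, Finset.sum_eq_single ⟨a, by omega⟩]
  · simp [natBasisElt_apply]
  · intro b _ hb
    have hb' : (b : ℕ) ≠ a := fun h => hb (Fin.ext h)
    simp [natBasisElt_apply, hb']
  · simp

lemma cyclicProj_nablaP_natBasisElt {k a : ℕ} (h : a < k) (p : ℂ[X]) :
    cyclicProj k (nablaP k (natBasisElt k a p)) = 0 := by
  obtain ⟨d, rfl⟩ := Nat.exists_eq_add_of_lt h
  rw [nablaP_natBasisElt h.le]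
  simp only [map_add, map_smul]
  rw [cyclicProj_natBasisElt h.le, cyclicProj_natBasisElt h, cyclicProj_natBasisElt (by omega)]
  have e₁ : a + d + 1 - a = d + 1 := by omega
  have e₂ : a + d + 1 - (a + 1) = d := by omega
  rw [e₁, e₂]
  rcases a with _ | a
  · rw [cyclicOp_zero, cyclicOp_one, Nat.factorial_succ]
    push_cast
    module
  · have e₃ : a + 1 + d + 1 - (a + 1 - 1) = d + 2 := by omega
    have e₄ : a + 1 + d + 1 - a = d + 2 := by omega
    rw [e₃, cyclicOp_add_two, e₄, Nat.factorial_succ (d + 1), Nat.factorial_succ d,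
      Nat.add_sub_cancel]
    simp only [Nat.succ_eq_add_one, pow_succ]
    push_cast
    module

lemma cyclicProj_nablaP_natBasisElt_self {k : ℕ} (hk : 1 ≤ k) (p : ℂ[X]) :
    cyclicProj k (nablaP k (natBasisElt k k p)) = cyclicOp k (k + 1) ((-1 : ℂ) ^ k • p) := by
  rw [nablaP_natBasisElt le_rfl]
  simp only [map_add, map_smul]
  rw [natBasisElt_eq_zero (Nat.lt_succ_self k), cyclicProj_natBasisElt le_rfl,
    cyclicProj_natBasisElt (by omega)]
  obtain ⟨n, rfl⟩ := Nat.exists_eq_add_of_le' hk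
  have e₁ : n + 1 - n = 1 := by omega
  rw [cyclicOp_add_two, Nat.add_sub_cancel, e₁, Nat.sub_self]
  simp only [Nat.factorial, map_zero, smul_zero]
  push_cast
  module

lemma cyclicProj_mem_range {k : ℕ} (hk : 1 ≤ k) {f : Fin (k + 1) → ℂ[X]}
    (hf : f ∈ LinearMap.range (nablaP k)) :
    cyclicProj k f ∈ LinearMap.range (cyclicOp k (k + 1)) := by
  obtain ⟨g, rfl⟩ := hf
  rw [← sum_natBasisElt k g, map_sum, map_sum]
  refine Submodule.sum_mem _ fun a _ => ?_
  rcases (Nat.lt_succ_iff.mp a.isLt).lt_or_eq with ha | ha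
  · rw [cyclicProj_nablaP_natBasisElt ha]
    exact Submodule.zero_mem _
  · rw [ha, cyclicProj_nablaP_natBasisElt_self hk]
    exact ⟨_, rfl⟩

lemma factorial_smul_natBasisElt_sub_mem_range (k a : ℕ) (h : a ≤ k) (p : ℂ[X]) :
    (k.factorial : ℂ) • natBasisElt k a p
      - natBasisElt k 0 (((-1) ^ a * ((k - a).factorial : ℂ)) • cyclicOp k a p)
      ∈ LinearMap.range (nablaP k) := by
  induction a using Nat.strong_induction_on generalizing p with
  | _ a ih =>
    rcases a with _ | a
    · simp [cyclicOp_zero]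
    · obtain ⟨d, rfl⟩ := Nat.exists_eq_add_of_lt h
      have hd : ((d + 1 : ℕ) : ℂ) ≠ 0 := Nat.cast_ne_zero.mpr d.succ_ne_zero
      refine (Submodule.smul_mem_iff _ hd).mp ?_
      have h₁ := ih a a.lt_succ_self (by omega) (derivative p)
      have h₂ : nablaP (a + d + 1) (natBasisElt (a + d + 1) a p) ∈ LinearMap.range _ := ⟨_, rfl⟩
      have hn := nablaP_natBasisElt (show a ≤ a + d + 1 by omega) p
      have e₁ : a + d + 1 - a = d + 1 := by omega
      have e₂ : a + d + 1 - (a + 1) = d := by omega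
      rw [e₁] at h₁ hn
      rw [e₂]
      rcases a with _ | a
      · convert Submodule.sub_mem _
          (Submodule.smul_mem _ ((0 + d + 1).factorial : ℂ) h₂) h₁ using 1
        rw [hn, cyclicOp_zero, cyclicOp_one, Nat.factorial_succ d]
        simp only [map_smul]
        push_cast
        module
      · have h₃ := ih a (by omega) (by omega) (X * p)
        have e₃ : a + 1 + d + 1 - a = d + 2 := by omega
        rw [e₃] at h₃
        convert Submodule.sub_mem _ (Submodule.sub_mem _
          (Submodule.smul_mem _ ((a + 1 + d + 1).factorial : ℂ) h₂) h₁)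
          (Submodule.smul_mem _ ((a + 1 : ℕ) : ℂ) h₃) using 1
        rw [hn, cyclicOp_add_two, e₃, Nat.factorial_succ (d + 1), Nat.factorial_succ d,
          Nat.add_sub_cancel]
        simp only [map_smul, map_sub, pow_succ]
        push_cast
        module

lemma factorial_smul_sub_mem_range (k : ℕ) (f : Fin (k + 1) → ℂ[X]) :
    (k.factorial : ℂ) • f - natBasisElt k 0 (cyclicProj k f) ∈ LinearMap.range (nablaP k) := by
  have h : (k.factorial : ℂ) • f - natBasisElt k 0 (cyclicProj k f)
      = ∑ a : Fin (k + 1), ((k.factorial : ℂ) • natBasisElt k a (f a)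
        - natBasisElt k 0 (((-1) ^ (a : ℕ) * ((k - a).factorial : ℂ)) • cyclicOp k a (f a))) := by
    rw [Finset.sum_sub_distrib, ← Finset.smul_sum, sum_natBasisElt, ← map_sum]
    simp [cyclicProj, LinearMap.sum_apply]
  rw [h]
  exact Submodule.sum_mem _ fun a _ =>
    factorial_smul_natBasisElt_sub_mem_range k a (Nat.lt_succ_iff.mp a.isLt) (f a)

/-- The operator `C_{k+1}` raises the degree of every monomial by exactly `m`, where `m = k'+1`
for `k` odd and `m = k'` for `k` even. -/
lemma cyclicOp_succ_raises_degree {k m : ℕ} (hk : 1 ≤ k)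
    (hm : m = if Odd k then (k - 1) / 2 + 1 else (k - 1) / 2) :
    (∀ i j, i + m < j → (cyclicOp k (k + 1) (X ^ i)).coeff j = 0) ∧
      ∀ i, (cyclicOp k (k + 1) (X ^ i)).coeff (i + m) ≠ 0 := by
  rcases Nat.even_or_odd' k with ⟨n, rfl | rfl⟩
  · rw [if_neg (by simp)] at hm
    obtain ⟨-, -, h₁, h₂⟩ := coeff_cyclicOp_X_pow (2 * n) n
    refine ⟨fun i j h => h₁ i j (by omega), fun i => ?_⟩
    obtain ⟨c, hc, hce⟩ := h₂ le_rfl i (i + m) (by omega)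
    rw [hce]
    exact mul_ne_zero (by simp) (Nat.cast_ne_zero.mpr hc.ne')
  · rw [if_pos (by simp)] at hm
    obtain rfl : m = n + 1 := by omega
    obtain ⟨h₁, h₂, -, -⟩ := coeff_cyclicOp_X_pow (2 * n + 1) (n + 1)
    refine ⟨h₁, fun i => ?_⟩
    obtain ⟨c, hc, hce⟩ := h₂ (by omega) i
    rw [show 2 * n + 1 + 1 = 2 * (n + 1) by ring, hce]
    exact mul_ne_zero (by simp) (Nat.cast_ne_zero.mpr hc.ne')

lemma linearIndependent_fam14 {k m : ℕ} (hk : 1 ≤ k)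
    (hlt : ∀ i j, i + m < j → (cyclicOp k (k + 1) (X ^ i)).coeff j = 0)
    (hne : ∀ i, (cyclicOp k (k + 1) (X ^ i)).coeff (i + m) ≠ 0) :
    LinearIndependent ℂ (fam14 k m) := by
  rw [Fintype.linearIndependent_iff]
  intro c hc i
  set p : ℂ[X] := ∑ i : Fin m, c i • X ^ (i : ℕ) with hp
  have hcoeff : ∀ j, p.coeff j = ∑ i : Fin m, if j = i then c i else 0 := fun j => by
    simp [hp, finsetSum_coeff, coeff_X_pow]
  have hmem : natBasisElt k 0 p ∈ LinearMap.range (nablaP k) := by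
    rw [← Submodule.Quotient.mk_eq_zero, ← hc, hp, map_sum, ← Submodule.mkQ_apply, map_sum]
    simp only [map_smul, fam14, eP_zero_eq, Submodule.mkQ_apply]
  have hpmem := cyclicProj_mem_range hk hmem
  rw [cyclicProj_natBasisElt k.zero_le, cyclicOp_zero, Submodule.smul_mem_iff _
    (by simp [Nat.factorial_ne_zero])] at hpmem
  have hp0 := eq_zero_of_mem_range_of_degree_lt hlt hne hpmem fun j hj => by
    rw [hcoeff]
    exact Finset.sum_eq_zero fun i _ => if_neg (by omega)
  have hi := hcoeff i
  rw [hp0] at hi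
  simpa [← Fin.ext_iff] using hi.symm

lemma span_fam14_eq_top {k m : ℕ} (hk : 1 ≤ k)
    (hlt : ∀ i j, i + m < j → (cyclicOp k (k + 1) (X ^ i)).coeff j = 0)
    (hne : ∀ i, (cyclicOp k (k + 1) (X ^ i)).coeff (i + m) ≠ 0) :
    Submodule.span ℂ (Set.range (fam14 k m)) = ⊤ := by
  have hfac : (k.factorial : ℂ) ≠ 0 := Nat.cast_ne_zero.mpr k.factorial_ne_zero
  let ψ := (LinearMap.range (nablaP k)).mkQ.comp (natBasisElt k 0)
  have hψ : ∀ f, (k.factorial : ℂ) • (LinearMap.range (nablaP k)).mkQ f = ψ (cyclicProj k f) := by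
    intro f
    rw [← map_smul, ← sub_eq_zero]
    simp only [ψ, LinearMap.comp_apply]
    rw [← map_sub, Submodule.mkQ_apply, Submodule.Quotient.mk_eq_zero]
    exact factorial_smul_sub_mem_range k f
  have hrange : ∀ q, ψ (cyclicOp k (k + 1) q) = 0 := by
    intro q
    have h := hψ (nablaP k (natBasisElt k k ((-1 : ℂ) ^ k • q)))
    rw [cyclicProj_nablaP_natBasisElt_self hk, smul_smul, ← mul_pow, neg_one_mul, neg_neg,
      one_pow, one_smul] at h
    rw [← h, Submodule.mkQ_apply,
      (Submodule.Quotient.mk_eq_zero _).mpr (LinearMap.mem_range_self _ _), smul_zero]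
  have hmap : Submodule.map ψ ⊤ ≤ Submodule.span ℂ (Set.range (fam14 k m)) := by
    rw [← span_X_pow_sup_range_eq_top hlt hne, Submodule.map_sup, Submodule.map_span]
    refine sup_le (Submodule.span_mono ?_) ?_
    · rintro _ ⟨_, ⟨i, rfl⟩, rfl⟩
      exact ⟨i, by simp [ψ, fam14, eP_zero_eq]⟩
    · rintro _ ⟨_, ⟨q, rfl⟩, rfl⟩
      rw [hrange]
      exact Submodule.zero_mem _
  refine eq_top_iff.mpr fun x _ => ?_
  obtain ⟨f, rfl⟩ := Submodule.mkQ_surjective _ x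
  rw [← Submodule.smul_mem_iff _ hfac, hψ]
  exact hmap (Submodule.mem_map_of_mem Submodule.mem_top)

/-- The classes of `z^{i−1}·u_0` for `i ∈ I_k` form a `ℂ`-basis of
`H¹_dR(𝔸¹, Sym^k Ai) = coker(∇ : Λ_0⁺ → Λ_0⁺)`, where `I_k = {1,…,k′+1}` for `k` odd and
`I_k = {1,…,k′}` for `k` even; in particular this cohomology has dimension `k′+1`
resp. `k′`. -/
theorem stmt_14 (k k' : ℕ) (hk : 1 ≤ k) (hk' : k' = (k - 1) / 2) :
    LinearIndependent ℂ (fam14 k (if Odd k then k' + 1 else k'))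
    ∧ Submodule.span ℂ (Set.range (fam14 k (if Odd k then k' + 1 else k'))) = ⊤
    ∧ Module.finrank ℂ ((Fin (k + 1) → Polynomial ℂ) ⧸ LinearMap.range (nablaP k))
        = (if Odd k then k' + 1 else k') := by
  subst hk'
  obtain ⟨hlt, hne⟩ := cyclicOp_succ_raises_degree hk rfl
  have hli := linearIndependent_fam14 hk hlt hne
  have hsp := span_fam14_eq_top hk hlt hne
  refine ⟨hli, hsp, ?_⟩
  rw [Module.finrank_eq_card_basis (Module.Basis.mk hli hsp.ge), Fintype.card_fin]
end

section
/- The maps α : coker(∇ : Λ_0⁺ → Λ_0⁺) → coker(θ_0 : Λ_0⁺ → Λ_0⁺), [v] ↦ [z·v], and Res : coker(θ_0 : Λ_0⁺ → Λ_0⁺) → ℂ^{k+1}, [Σ_{a=0}^{k} p_a·u_a] ↦ (p_0(0), …, p_k(0)), are well defined, and the sequence 0 → coker(∇) → coker(θ_0 on Λ_0⁺) → ℂ^{k+1} → 0 is exact. (This is the residue exact sequence 0 → H^1_dR(𝔸¹, Sym^k Ai) → H^1_dR(𝔾_m, Sym^k Ai) → (Sym^k Ai)_0 → 0, where (Sym^k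 Ai)_0 is the fiber at z = 0.) -/
open Polynomial

/-- On `Λ_0⁺` the operator `z∂_z` is `z` times the operator `∂_z`. -/
theorem thetaP_zero_eq_X_mul_nablaP (k : ℕ) (w : Fin (k + 1) → Polynomial ℂ) :
    thetaP k 0 w = fun b => X * nablaP k w b := by
  funext b
  simp only [thetaP, nablaP, LinearMap.pi_apply, LinearMap.add_apply]
  split_ifs <;> simp [smul_eq_C_mul] <;> ring

/-- The residue exact sequence
`0 → H¹_dR(𝔸¹, Sym^k Ai) → H¹_dR(𝔾_m, Sym^k Ai) → (Sym^k Ai)_0 → 0`: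
the map `α : coker ∇ → coker θ_0`, `[v] ↦ [z·v]`, and the residue map
`Res : coker θ_0 → ℂ^{k+1}`, `[Σ p_a·u_a] ↦ (p_a(0))_a`, are well defined, `α` is injective,
the kernel of `Res` is exactly the image of `α`, and `Res` is surjective. -/
theorem stmt_15 (k : ℕ) (hk : 1 ≤ k) :
    -- α is well defined: `z·∇w` lies in the image of `θ_0`
    (∀ w : Fin (k + 1) → Polynomial ℂ,
        (fun b => X * (nablaP k w) b) ∈ LinearMap.range (thetaP k 0))
    -- Res is well defined: it vanishes on the image of `θ_0`
    ∧ (∀ w : Fin (k + 1) → Polynomial ℂ, ∀ b, ((thetaP k 0 w) b).eval 0 = 0)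
    -- exactness at `coker ∇`: `α` is injective
    ∧ (∀ v : Fin (k + 1) → Polynomial ℂ,
        (fun b => X * v b) ∈ LinearMap.range (thetaP k 0) → v ∈ LinearMap.range (nablaP k))
    -- exactness at `coker θ_0`: `ker Res = im α`
    ∧ (∀ f : Fin (k + 1) → Polynomial ℂ,
        (∀ b, (f b).eval 0 = 0) ↔
          ∃ v w : Fin (k + 1) → Polynomial ℂ, f = (fun b => X * v b) + thetaP k 0 w)
    -- exactness at `ℂ^{k+1}`: `Res` is surjective
    ∧ (∀ c : Fin (k + 1) → ℂ,
        ∃ f : Fin (k + 1) → Polynomial ℂ, ∀ b, (f b).eval 0 = c b) := by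
  refine ⟨fun w => ⟨w, thetaP_zero_eq_X_mul_nablaP k w⟩, fun w b => ?_, ?_,
    fun f => ⟨fun hf => ?_, ?_⟩, fun c => ⟨fun b => C (c b), fun b => eval_C⟩⟩
  · simp [thetaP_zero_eq_X_mul_nablaP]
  · rintro v ⟨w, hw⟩
    rw [thetaP_zero_eq_X_mul_nablaP] at hw
    exact ⟨w, funext fun b => mul_left_cancel₀ X_ne_zero (congrFun hw b)⟩
  · refine ⟨fun b => (f b).divX, 0, funext fun b => ?_⟩
    have h : (f b).coeff 0 = 0 := by rw [coeff_zero_eq_eval_zero, hf b]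
    simpa [h] using (X_mul_divX_add (f b)).symm
  · rintro ⟨v, w, rfl⟩ b
    simp [thetaP_zero_eq_X_mul_nablaP]
end

section
/- Let k be even, write k = 2k′+2, let ε ∈ {0,1,2}, and let p ∈ ℤ with p > k/2 + 1. Then A + B + C = N, where A = #{i : 1 ≤ i ≤ k′ and k+1−(k+2i)/3 = p−ε/3}, B = #{i : 1 ≤ i ≤ k′ and k+1−(k+2i+1)/3 = p−ε/3}, C = #{j : 0 ≤ j ≤ k and k+1−(k+j+1)/3 = p−ε/3}, and N = #{j : 0 ≤ j ≤ k, k+j+ε is not divisible by 3, and ⌊(k+j+ε)/3⌋ = p−1}. -/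
/-- Counting identity for the levels of the filtration `G` versus the fibers of `ρ_ε`,
for `k` even, `ε ∈ {0,1,2}` and `p > k/2 + 1`. -/
theorem stmt_18 (k k' : ℕ) (hk : k = 2 * k' + 2) (ε : ℕ) (hε : ε < 3)
    (p : ℤ) (hp : (k : ℤ) / 2 + 1 < p) :
    ((Finset.Icc 1 k').filter (fun i : ℕ =>
        (k : ℚ) + 1 - ((k : ℚ) + 2 * (i : ℚ)) / 3 = (p : ℚ) - (ε : ℚ) / 3)).card
  + ((Finset.Icc 1 k').filter (fun i : ℕ =>
        (k : ℚ) + 1 - ((k : ℚ) + 2 * (i : ℚ) + 1) / 3 = (p : ℚ) - (ε : ℚ) / 3)).card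
  + ((Finset.range (k + 1)).filter (fun j : ℕ =>
        (k : ℚ) + 1 - ((k : ℚ) + (j : ℚ) + 1) / 3 = (p : ℚ) - (ε : ℚ) / 3)).card
  = ((Finset.range (k + 1)).filter (fun j : ℕ =>
        ¬ (3 ∣ (k + j + ε)) ∧ (((k + j + ε) / 3 : ℕ) : ℤ) = p - 1)).card := by
  have hA : ∀ i : ℕ, ((k : ℚ) + 1 - ((k : ℚ) + 2 * (i : ℚ)) / 3 = (p : ℚ) - (ε : ℚ) / 3) ↔
      2 * (i : ℤ) = 2 * k + 3 - 3 * p + ε := by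
    intro i
    rw [← @Int.cast_inj ℚ]
    push_cast
    constructor <;> intro h <;> linarith
  have hB : ∀ i : ℕ, ((k : ℚ) + 1 - ((k : ℚ) + 2 * (i : ℚ) + 1) / 3 = (p : ℚ) - (ε : ℚ) / 3) ↔
      2 * (i : ℤ) + 1 = 2 * k + 3 - 3 * p + ε := by
    intro i
    rw [← @Int.cast_inj ℚ]
    push_cast
    constructor <;> intro h <;> linarith
  have hC : ∀ j : ℕ, ((k : ℚ) + 1 - ((k : ℚ) + (j : ℚ) + 1) / 3 = (p : ℚ) - (ε : ℚ) / 3) ↔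
      (j : ℤ) + 1 = 2 * k + 3 - 3 * p + ε := by
    intro j
    rw [← @Int.cast_inj ℚ]
    push_cast
    constructor <;> intro h <;> linarith
  simp only [hA, hB, hC]
  clear hA hB hC
  obtain hM | ⟨m, hm⟩ : 2 * (k : ℤ) + 3 - 3 * p + ε ≤ 0 ∨
      ∃ m : ℕ, 2 * (k : ℤ) + 3 - 3 * p + ε = m + 1 := by
    by_cases h : 2 * (k : ℤ) + 3 - 3 * p + ε ≤ 0
    · exact Or.inl h
    · exact Or.inr ⟨(2 * (k : ℤ) + 2 - 3 * p + ε).toNat, by omega⟩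
  · rw [Finset.filter_false_of_mem, Finset.filter_false_of_mem, Finset.filter_false_of_mem,
      Finset.filter_false_of_mem] <;> simp only [Finset.mem_Icc, Finset.mem_range,
        Finset.card_empty] <;> intros <;> omega
  have hmk : m < k' := by omega
  have cardC : ((Finset.range (k + 1)).filter (fun j : ℕ =>
      (j : ℤ) + 1 = 2 * k + 3 - 3 * p + ε)).card = 1 := by
    rw [Finset.card_eq_one]
    refine ⟨m, ?_⟩
    ext j
    simp only [Finset.mem_filter, Finset.mem_range, Finset.mem_singleton]
    omega
  rw [cardC]
  obtain rfl | hm0 := Nat.eq_zero_or_pos m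
  · rw [Finset.filter_false_of_mem, Finset.filter_false_of_mem, Finset.card_empty, eq_comm,
      Finset.card_eq_one]
    · refine ⟨k, ?_⟩
      ext j
      simp only [Finset.mem_filter, Finset.mem_range, Finset.mem_singleton]
      omega
    all_goals
      simp only [Finset.mem_Icc]
      intros
      omega
  have cardN : ((Finset.range (k + 1)).filter (fun j : ℕ =>
      ¬ (3 ∣ (k + j + ε)) ∧ (((k + j + ε) / 3 : ℕ) : ℤ) = p - 1)).card = 2 := by
    rw [Finset.card_eq_two]
    refine ⟨k - m, k - m + 1, by omega, ?_⟩
    ext j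
    simp only [Finset.mem_filter, Finset.mem_range, Finset.mem_insert, Finset.mem_singleton]
    omega
  rw [cardN]
  suffices h : ((Finset.Icc 1 k').filter (fun i : ℕ =>
        2 * (i : ℤ) = 2 * k + 3 - 3 * p + ε)).card +
      ((Finset.Icc 1 k').filter (fun i : ℕ =>
        2 * (i : ℤ) + 1 = 2 * k + 3 - 3 * p + ε)).card = 1 by rw [h]
  rw [← Finset.card_union_of_disjoint, Finset.card_eq_one]
  · refine ⟨(m + 1) / 2, ?_⟩
    ext i
    simp only [Finset.mem_union, Finset.mem_filter, Finset.mem_Icc, Finset.mem_singleton]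
    omega
  · rw [Finset.disjoint_filter]
    intros
    omega
end
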